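/- Let P̃ be the law on Θ × (0,1) of the pair (W, 1 − H(R)), where R = ‖X‖ and W = X/‖X‖, and let Ψ(C) = ν({z : ‖z‖ ≥ 1, z/‖z‖ ∈ C}) be the spectral measure. Then, as n → ∞, sup over all spherical caps C ∈ 𝒞₁ = { C_w(a) : w ∈ Θ, 0 < a ≤ 1 } and all 0 < s ≤ 2 of (1/λ(C)) | (n/k) P̃( C × (0, sk/n] ) − s Ψ(C) | converges to 0. -/

import Mathlib

open MeasureTheory Filter Topology RealInnerProductSpace

open Set Metric in
theorem hausdorffMeasure_unitSphere_lt_top (m : ℕ) :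
    μH[(m : ℝ)] (sphere (0 : EuclideanSpace ℝ (Fin (m + 1))) 1) < ⊤ := by
  let e : Fin (m + 1) → ℝ → (Fin m → ℝ) → EuclideanSpace ℝ (Fin (m + 1)) :=
    fun i c x => WithLp.toLp 2 (i.insertNth (α := fun _ => ℝ) c x)
  let g : Fin (m + 1) → ℝ → (Fin m → ℝ) → EuclideanSpace ℝ (Fin (m + 1)) :=
    fun i c x => ‖e i c x‖⁻¹ • e i c x
  have he : ∀ i c, ContDiff ℝ 1 (e i c) := by
    intro i c
    rw [contDiff_euclidean]
    intro j
    refine Fin.succAboveCases i ?_ ?_ j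
    · simpa [e] using contDiff_const
    · intro l
      simpa [e] using contDiff_apply ℝ ℝ l
  have hne : ∀ i, ∀ c : ℝ, c ≠ 0 → ∀ x, e i c x ≠ 0 := by
    intro i c hc x h
    apply hc
    have := congrArg (fun v : EuclideanSpace ℝ (Fin (m + 1)) => v i) h
    simpa [e] using this
  have hg : ∀ i, ∀ c : ℝ, c ≠ 0 → μH[(m : ℝ)] (g i c '' Icc (-1) 1) < ⊤ := by
    intro i c hc
    have hcd : ContDiff ℝ 1 (g i c) :=
      (((he i c).norm ℝ (hne i c hc)).inv fun x => norm_ne_zero_iff.2 (hne i c hc x)).smul (he i c)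
    obtain ⟨K, hK⟩ := hcd.contDiffOn.exists_lipschitzOnWith one_ne_zero
      (convex_Icc (-1 : Fin m → ℝ) 1) isCompact_Icc
    refine (hK.hausdorffMeasure_image_le (Nat.cast_nonneg m)).trans_lt ?_
    refine ENNReal.mul_lt_top (ENNReal.rpow_lt_top_of_nonneg (Nat.cast_nonneg m)
      ENNReal.coe_ne_top) ?_
    have := hausdorffMeasure_pi_real (ι := Fin m)
    rw [Fintype.card_fin] at this
    rw [this]
    exact isCompact_Icc.measure_lt_top
  have hcover : sphere (0 : EuclideanSpace ℝ (Fin (m + 1))) 1 ⊆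
      ⋃ i, (g i 1 '' Icc (-1) 1 ∪ g i (-1) '' Icc (-1) 1) := by
    intro v hv
    have hv1 : ‖v‖ = 1 := by simpa using hv
    obtain ⟨i, hi⟩ := Finite.exists_max (fun j => |v j|)
    have hvi : v i ≠ 0 := by
      intro h0
      have : v = 0 := by
        ext j
        have := hi j
        rw [h0, abs_zero] at this
        simpa using this
      simp [this] at hv1
    have hpos : 0 < |v i| := abs_pos.2 hvi
    let x : Fin m → ℝ := fun j => |v i|⁻¹ * v (i.succAbove j)
    have hx : x ∈ Icc (-1 : Fin m → ℝ) 1 := by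
      have : ∀ j, |x j| ≤ 1 := by
        intro j
        simp only [x]
        rw [abs_mul, abs_inv, abs_abs, inv_mul_le_iff₀ hpos, mul_one]
        exact hi _
      exact ⟨fun j => (abs_le.1 (this j)).1, fun j => (abs_le.1 (this j)).2⟩
    have hex : ∀ c, c = |v i|⁻¹ * v i → e i c x = |v i|⁻¹ • v := by
      intro c hc
      ext j
      refine Fin.succAboveCases i ?_ ?_ j
      · simp [e, hc]
      · intro l
        simp [e, x]
    have hgx : ∀ c, c = |v i|⁻¹ * v i → g i c x = v := by
      intro c hc
      simp only [g]
      rw [hex c hc, norm_smul, hv1, norm_inv, Real.norm_eq_abs, abs_abs, mul_one, inv_inv,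
        smul_smul, mul_inv_cancel₀ hpos.ne', one_smul]
    refine mem_iUnion.2 ⟨i, ?_⟩
    rcases lt_or_gt_of_ne hvi with h | h
    · right
      refine ⟨x, hx, hgx _ ?_⟩
      rw [abs_of_neg h]; field_simp
    · left
      refine ⟨x, hx, hgx _ ?_⟩
      rw [abs_of_pos h]; field_simp
  refine (measure_mono hcover).trans_lt ((measure_iUnion_le _).trans_lt ?_)
  rw [tsum_fintype]
  refine ENNReal.sum_lt_top.2 fun i _ => ?_
  exact (measure_union_le _ _).trans_lt
    (ENNReal.add_lt_top.2 ⟨hg i 1 one_ne_zero, hg i (-1) (by norm_num)⟩)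

open Set Metric in
theorem lintegral_cone_norm {E : Type*} [NormedAddCommGroup E] [NormedSpace ℝ E]
    [FiniteDimensional ℝ E] [Nontrivial E] [MeasurableSpace E] [BorelSpace E] (μ : Measure E)
    [μ.IsAddHaarMeasure] (C : Set E) (hC : MeasurableSet C) (φ : ℝ → ENNReal)
    (hφ : Measurable φ) :
    ∫⁻ y in {y : E | ‖y‖⁻¹ • y ∈ C}, φ ‖y‖ ∂μ =
      μ.toSphere ((↑) ⁻¹' C) *
        ∫⁻ r, φ (r : ℝ) ∂(Measure.volumeIoiPow (Module.finrank ℝ E - 1)) := by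
  have hN : Measurable fun y : E => ‖y‖⁻¹ • y := by fun_prop
  have hA : MeasurableSet {y : E | ‖y‖⁻¹ • y ∈ C} := hN hC
  have hC' : MeasurableSet ((↑) ⁻¹' C : Set (sphere (0 : E) 1)) := measurable_subtype_coe hC
  let F : E → ENNReal := {y : E | ‖y‖⁻¹ • y ∈ C}.indicator fun y => φ ‖y‖
  have hF : Measurable F := (hφ.comp measurable_norm).indicator hA
  rw [← lintegral_indicator hA]
  change ∫⁻ y, F y ∂μ = _
  have h0 : MeasurableSet ({0}ᶜ : Set E) := (measurableSet_singleton 0).compl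
  have h1 : ∫⁻ y, F y ∂μ = ∫⁻ y : ({0}ᶜ : Set E), F y ∂(μ.comap (↑)) := by
    rw [lintegral_subtype_comap h0, restrict_compl_singleton]
  rw [h1]
  have h2 := (μ.measurePreserving_homeomorphUnitSphereProd).lintegral_comp
    (f := fun p => ((↑) ⁻¹' C : Set (sphere (0 : E) 1)).indicator 1 p.1 * φ (p.2 : ℝ)) ?_
  · rw [lintegral_prod_mul (μ := μ.toSphere)
      (f := ((↑) ⁻¹' C : Set (sphere (0 : E) 1)).indicator 1) (g := fun r : Ioi (0:ℝ) => φ r)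
      ((measurable_const.indicator hC').aemeasurable)
      ((hφ.comp measurable_subtype_coe).aemeasurable), lintegral_indicator_one hC'] at h2
    rw [← h2]
    refine lintegral_congr fun y => ?_
    by_cases hy : ‖(y : E)‖⁻¹ • (y : E) ∈ C
    · simp [F, indicator, hy]
    · simp [F, indicator, hy]
  · exact ((measurable_const.indicator hC').comp measurable_fst).mul
      (hφ.comp (measurable_subtype_coe.comp measurable_snd))

open Set Metric in
theorem toSphere_univ_mul_lintegral_cone_norm {E : Type*} [NormedAddCommGroup E]
    [NormedSpace ℝ E] [FiniteDimensional ℝ E] [Nontrivial E] [MeasurableSpace E] [BorelSpace E]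
    (μ : Measure E) [μ.IsAddHaarMeasure] (C : Set E) (hC : MeasurableSet C) (φ : ℝ → ENNReal)
    (hφ : Measurable φ) :
    μ.toSphere univ * ∫⁻ y in {y : E | ‖y‖⁻¹ • y ∈ C}, φ ‖y‖ ∂μ =
      μ.toSphere ((↑) ⁻¹' C) * ∫⁻ y, φ ‖y‖ ∂μ := by
  have h := lintegral_cone_norm μ univ MeasurableSet.univ φ hφ
  simp only [mem_univ, ofPred_true, Measure.restrict_univ, preimage_univ] at h
  rw [h, lintegral_cone_norm μ C hC φ hφ]
  ring

open Set Metric in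
theorem measure_cone_closedBall_le {E : Type*} [NormedAddCommGroup E] [NormedSpace ℝ E]
    [FiniteDimensional ℝ E] [MeasurableSpace E] [BorelSpace E] (μ : Measure E)
    [μ.IsAddHaarMeasure] (m : ℕ) (hm : Module.finrank ℝ E = m + 1) (v : E) (hv : ‖v‖ = 1)
    (ρ : ℝ) (hρ : 0 < ρ) (hρ1 : ρ ≤ 1) :
    μ (ball 0 1 ∩ {y | ‖y‖⁻¹ • y ∈ closedBall v ρ}) ≤
      ENNReal.ofReal (3 * 2 ^ (m + 1)) * μ (closedBall 0 1) * ENNReal.ofReal (ρ ^ m) := by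
  set N := ⌈ρ⁻¹⌉₊ with hN
  have hN1 : ρ⁻¹ ≤ N := Nat.le_ceil _
  have hN2 : (N : ℝ) < ρ⁻¹ + 1 := Nat.ceil_lt_add_one (by positivity)
  have hN0 : (0 : ℝ) < N := lt_of_lt_of_le (by positivity) hN1
  have hNρ : (N : ℝ)⁻¹ ≤ ρ := inv_le_of_inv_le₀ hρ hN1
  have hcover : ball 0 1 ∩ {y | ‖y‖⁻¹ • y ∈ closedBall v ρ} ⊆
      ⋃ j ∈ Finset.range (N + 1), closedBall (((j : ℝ) / N) • v) (2 * ρ) := by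
    rintro y ⟨hy1, hy2⟩
    have hy1' : ‖y‖ < 1 := by simpa using hy1
    have hy2' : ‖‖y‖⁻¹ • y - v‖ ≤ ρ := by simpa [dist_eq_norm] using hy2
    have hr0 : 0 ≤ ‖y‖ * N := by positivity
    have h1 : ‖y - ‖y‖ • v‖ ≤ ρ := by
      rcases eq_or_ne y 0 with rfl | hy
      · simpa using hρ.le
      · have hyn : ‖y‖ ≠ 0 := norm_ne_zero_iff.2 hy
        have : y - ‖y‖ • v = ‖y‖ • (‖y‖⁻¹ • y - v) := by
          rw [smul_sub, smul_inv_smul₀ hyn]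
        rw [this, norm_smul, norm_norm]
        calc ‖y‖ * ‖‖y‖⁻¹ • y - v‖ ≤ 1 * ρ := by gcongr
          _ = ρ := one_mul _
    have hj1 := Nat.floor_le hr0
    have hj2 := Nat.lt_floor_add_one (‖y‖ * N)
    set j := ⌊‖y‖ * N⌋₊
    have h2 : |‖y‖ - j / N| ≤ ρ := by
      refine le_trans ?_ hNρ
      have : ‖y‖ - j / N = (‖y‖ * N - j) * (N : ℝ)⁻¹ := by field_simp
      rw [this, abs_of_nonneg (mul_nonneg (by linarith) (by positivity))]
      exact mul_le_of_le_one_left (by positivity) (by linarith)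
    have hjN : j < N + 1 := by
      have : (j : ℝ) < N + 1 := by nlinarith
      exact_mod_cast this
    refine mem_iUnion₂.2 ⟨j, Finset.mem_range.2 hjN, ?_⟩
    rw [mem_closedBall, dist_eq_norm]
    have : y - ((j : ℝ) / N) • v = (y - ‖y‖ • v) + (‖y‖ - j / N) • v := by
      rw [sub_smul]; abel
    rw [this]
    refine (norm_add_le _ _).trans ?_
    rw [norm_smul, hv, mul_one, Real.norm_eq_abs]
    linarith
  refine (measure_mono hcover).trans ((measure_biUnion_finset_le _ _).trans ?_)
  have hb : ∀ x : E, μ (closedBall x (2 * ρ)) =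
      ENNReal.ofReal ((2 * ρ) ^ (m + 1)) * μ (closedBall 0 1) := by
    intro x
    rw [Measure.addHaar_closedBall' μ x (by positivity), hm]
  simp only [hb, Finset.sum_const, Finset.card_range, nsmul_eq_mul]
  have hNE : ((N + 1 : ℕ) : ENNReal) = ENNReal.ofReal (N + 1) := by
    rw [← ENNReal.ofReal_natCast]; push_cast; rfl
  rw [hNE, ← mul_assoc, ← ENNReal.ofReal_mul (by positivity),
    mul_right_comm (ENNReal.ofReal _) (μ _), ← ENNReal.ofReal_mul (by positivity)]
  refine mul_le_mul' (ENNReal.ofReal_le_ofReal ?_) le_rfl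
  have h3 : (N + 1) * ρ ≤ 3 := by
    have : ρ⁻¹ * ρ = 1 := inv_mul_cancel₀ hρ.ne'
    nlinarith
  calc (N + 1) * (2 * ρ) ^ (m + 1) = ((N + 1) * ρ) * (2 ^ (m + 1) * ρ ^ m) := by
        rw [mul_pow, pow_succ ρ]; ring
    _ ≤ 3 * (2 ^ (m + 1) * ρ ^ m) := by gcongr
    _ = 3 * 2 ^ (m + 1) * ρ ^ m := by ring

open Set Metric in
theorem measure_cone_le_hausdorffMeasure {E : Type*} [NormedAddCommGroup E] [NormedSpace ℝ E]
    [FiniteDimensional ℝ E] [MeasurableSpace E] [BorelSpace E] (μ : Measure E)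
    [μ.IsAddHaarMeasure] (m : ℕ) (hm0 : m ≠ 0) (hm : Module.finrank ℝ E = m + 1) :
    ∃ K : ENNReal, K ≠ ⊤ ∧ ∀ C : Set E, MeasurableSet C →
      μ (ball 0 1 ∩ {y | ‖y‖⁻¹ • y ∈ C}) ≤ K * μH[(m : ℝ)] C := by
  have hnt : Nontrivial E := Module.nontrivial_of_finrank_pos (R := ℝ) (by omega)
  set K := ENNReal.ofReal (3 * 2 ^ (m + 1)) * μ (closedBall (0 : E) 1) with hK
  have hK0 : K ≠ 0 := mul_ne_zero (ENNReal.ofReal_pos.2 (by positivity)).ne'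
    (measure_closedBall_pos μ 0 one_pos).ne'
  have hKt : K ≠ ⊤ := ENNReal.mul_ne_top ENNReal.ofReal_ne_top measure_closedBall_lt_top.ne
  have hN : Measurable fun y : E => ‖y‖⁻¹ • y := by fun_prop
  set μ₁ := (μ.restrict (ball 0 1)).map fun y : E => ‖y‖⁻¹ • y with hμ₁
  have hμ₁_apply : ∀ C, MeasurableSet C → μ₁ C = μ (ball 0 1 ∩ {y | ‖y‖⁻¹ • y ∈ C}) := by
    intro C hC
    rw [hμ₁, Measure.map_apply hN hC, Measure.restrict_apply (hN hC), inter_comm]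
    rfl
  have hkey : ∀ s : Set E, Metric.ediam s ≤ 1 → μ₁ s ≤ K * (Metric.ediam s) ^ (m : ℝ) := by
    intro s hs
    by_cases hv : ∃ v ∈ s, ‖v‖ = 1
    · obtain ⟨v, hvs, hv1⟩ := hv
      have hst : Metric.ediam s ≠ ⊤ := ne_top_of_le_ne_top ENNReal.one_ne_top hs
      have hρ : ∀ ρ : ℝ, 0 < ρ → ρ ≤ 1 → Metric.ediam s ≤ ENNReal.ofReal ρ →
          μ₁ s ≤ K * ENNReal.ofReal (ρ ^ m) := by
        intro ρ h0 h1 h2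
        have hsub : s ⊆ closedBall v ρ := by
          intro x hx
          rw [mem_closedBall, ← ENNReal.ofReal_le_ofReal_iff h0.le, ← edist_dist]
          exact (edist_le_ediam_of_mem hx hvs).trans h2
        refine (measure_mono hsub).trans ?_
        rw [hμ₁_apply _ measurableSet_closedBall]
        exact measure_cone_closedBall_le μ m hm v hv1 ρ h0 h1
      rcases eq_or_ne (Metric.ediam s) 0 with h0 | h0
      · have hlim : Tendsto (fun ρ : ℝ => K * ENNReal.ofReal (ρ ^ m)) (𝓝[>] 0) (𝓝 0) := by
          have : Tendsto (fun ρ : ℝ => K * ENNReal.ofReal (ρ ^ m)) (𝓝 0)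
              (𝓝 (K * ENNReal.ofReal ((0 : ℝ) ^ m))) :=
            ENNReal.Tendsto.const_mul
              (ENNReal.tendsto_ofReal ((continuous_pow m).tendsto 0)) (Or.inr hKt)
          rw [zero_pow hm0, ENNReal.ofReal_zero, mul_zero] at this
          exact this.mono_left nhdsWithin_le_nhds
        refine (ge_of_tendsto hlim ?_).trans (zero_le)
        filter_upwards [Ioc_mem_nhdsGT (one_pos : (0 : ℝ) < 1)] with ρ hρ'
        exact hρ ρ hρ'.1 hρ'.2 (by simp [h0])
      · have hpos := ENNReal.toReal_pos h0 hst
        refine (hρ _ hpos ?_ (ENNReal.ofReal_toReal hst).ge).trans ?_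
        · exact ENNReal.toReal_le_of_le_ofReal zero_le_one (by simpa using hs)
        · rw [ENNReal.ofReal_pow hpos.le, ENNReal.ofReal_toReal hst, ENNReal.rpow_natCast]
    · have hsub : s ⊆ {v | ‖v‖ = 1}ᶜ := fun v hvs h => hv ⟨v, hvs, h⟩
      have hmeas : MeasurableSet {v : E | ‖v‖ = 1}ᶜ :=
        (measurableSet_eq_fun measurable_norm measurable_const).compl
      refine le_trans ?_ (zero_le)
      refine (measure_mono hsub).trans ?_
      rw [hμ₁_apply _ hmeas]
      refine (measure_mono (t := {0}) ?_).trans_eq (measure_singleton 0)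
      rintro y ⟨-, hy⟩
      by_contra hne
      apply hy
      have : ‖y‖ ≠ 0 := norm_ne_zero_iff.2 hne
      simp [norm_smul, this]
  have hle : K⁻¹ • μ₁ ≤ μH[(m : ℝ)] := by
    refine Measure.le_hausdorffMeasure _ _ 1 one_pos fun s hs => ?_
    rw [Measure.smul_apply, smul_eq_mul, ENNReal.inv_mul_le_iff hK0 hKt]
    exact hkey s hs
  refine ⟨K, hKt, fun C hC => ?_⟩
  rw [← hμ₁_apply C hC, ← ENNReal.inv_mul_le_iff hK0 hKt]
  exact hle C

open Set Metric in
theorem toSphere_le_hausdorffMeasure {E : Type*} [NormedAddCommGroup E] [NormedSpace ℝ E]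
    [FiniteDimensional ℝ E] [MeasurableSpace E] [BorelSpace E] (μ : Measure E)
    [μ.IsAddHaarMeasure] (m : ℕ) (hm0 : m ≠ 0) (hm : Module.finrank ℝ E = m + 1) :
    ∃ K : ENNReal, K ≠ ⊤ ∧ ∀ C : Set E, MeasurableSet C →
      μ.toSphere ((↑) ⁻¹' C) ≤ K * μH[(m : ℝ)] C := by
  obtain ⟨K, hK, h⟩ := measure_cone_le_hausdorffMeasure μ m hm0 hm
  refine ⟨(m + 1 : ℕ) * K, ENNReal.mul_ne_top (ENNReal.natCast_ne_top _) hK, fun C hC => ?_⟩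
  rw [Measure.toSphere_apply' μ (measurable_subtype_coe hC), hm, mul_assoc]
  gcongr
  refine le_trans (measure_mono ?_) (h C hC)
  rintro _ ⟨r, hr, _, ⟨v, hv, rfl⟩, rfl⟩
  have hv1 : ‖(v : E)‖ = 1 := by simp
  have hr0 : (0 : ℝ) < r := hr.1
  constructor
  · simp [norm_smul, hv1, abs_of_pos hr0, hr.2]
  · simpa [norm_smul, hv1, abs_of_pos hr0, smul_smul, hr0.ne'] using hv

theorem exists_potter_bound {V : ℝ → ℝ} (hpos : ∀ t, 0 < V t) (hanti : Antitone V) {α : ℝ}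
    (hα : 0 < α)
    (hrv : ∀ x > (0 : ℝ), Tendsto (fun t => V (t * x) / V t) atTop (𝓝 (x ^ (-α)))) :
    ∃ β > (0 : ℝ), ∃ K > (0 : ℝ), ∃ T₁ > (0 : ℝ), ∀ T ≥ T₁, ∀ r ≥ (1 : ℝ),
      V (T * r) / V T ≤ K * r ^ (-β) := by
  have hlt : (2 : ℝ) ^ (-α) < 2 ^ (-(α / 2)) :=
    Real.rpow_lt_rpow_of_exponent_lt one_lt_two (by linarith)
  obtain ⟨T₁, hT₁⟩ := eventually_atTop.1 (((hrv 2 two_pos).eventually (gt_mem_nhds hlt)).and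
    (eventually_gt_atTop 0))
  have hT₁0 := (hT₁ T₁ le_rfl).2
  refine ⟨α / 2, by positivity, 2 ^ (α / 2), by positivity, T₁, hT₁0, fun T hT r hr => ?_⟩
  have hT0 : 0 < T := hT₁0.trans_le hT
  have hpow : ∀ j : ℕ, V (T * 2 ^ j) ≤ ((2 : ℝ) ^ (-(α / 2))) ^ j * V T := by
    intro j
    induction j with
    | zero => simp
    | succ j ih =>
      have h1 : T ≤ T * 2 ^ j := le_mul_of_one_le_right hT0.le (one_le_pow₀ one_le_two)
      have h2 := (hT₁ (T * 2 ^ j) (hT.trans h1)).1.le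
      rw [div_le_iff₀ (hpos _)] at h2
      calc V (T * 2 ^ (j + 1)) = V (T * 2 ^ j * 2) := by rw [pow_succ, mul_assoc]
        _ ≤ 2 ^ (-(α / 2)) * V (T * 2 ^ j) := h2
        _ ≤ 2 ^ (-(α / 2)) * (((2 : ℝ) ^ (-(α / 2))) ^ j * V T) := by gcongr
        _ = _ := by rw [pow_succ]; ring
  obtain ⟨j, hj1, hj2⟩ := exists_nat_pow_near hr one_lt_two
  have hr0 : 0 < r := by linarith
  rw [div_le_iff₀ (hpos _)]
  calc V (T * r) ≤ V (T * 2 ^ j) := hanti (by gcongr)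
    _ ≤ ((2 : ℝ) ^ (-(α / 2))) ^ j * V T := hpow j
    _ ≤ (2 ^ (α / 2) * r ^ (-(α / 2))) * V T := by
      refine mul_le_mul_of_nonneg_right ?_ (hpos T).le
      have h3 : ((2 : ℝ) ^ (j + 1)) ^ (-(α / 2)) ≤ r ^ (-(α / 2)) :=
        Real.rpow_le_rpow_of_nonpos hr0 hj2.le (by linarith)
      have h4 : ((2 : ℝ) ^ (j + 1)) ^ (-(α / 2)) = ((2 : ℝ) ^ (-(α / 2))) ^ (j + 1) := by
        rw [← Real.rpow_natCast, ← Real.rpow_natCast, ← Real.rpow_mul two_pos.le,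
          ← Real.rpow_mul two_pos.le, mul_comm]
      have h5 : (2 : ℝ) ^ (α / 2) * 2 ^ (-(α / 2)) = 1 := by
        rw [← Real.rpow_add two_pos]; simp
      calc ((2 : ℝ) ^ (-(α / 2))) ^ j
          = (2 ^ (α / 2) * 2 ^ (-(α / 2))) * ((2 : ℝ) ^ (-(α / 2))) ^ j := by rw [h5, one_mul]
        _ = 2 ^ (α / 2) * ((2 : ℝ) ^ (j + 1)) ^ (-(α / 2)) := by rw [h4, pow_succ]; ring
        _ ≤ _ := by gcongr

theorem integrableOn_norm_rpow_neg {E : Type*} [NormedAddCommGroup E] [NormedSpace ℝ E]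
    [FiniteDimensional ℝ E] [MeasurableSpace E] [BorelSpace E] (μ : Measure E)
    [μ.IsAddHaarMeasure] {p : ℝ} (hp : (Module.finrank ℝ E : ℝ) < p) :
    IntegrableOn (fun y : E => ‖y‖ ^ (-p)) {y | 1 ≤ ‖y‖} μ := by
  have hp0 : 0 < p := lt_of_le_of_lt (Nat.cast_nonneg _) hp
  have hX : MeasurableSet {y : E | 1 ≤ ‖y‖} := measurableSet_le measurable_const measurable_norm
  refine Integrable.mono' (((integrable_one_add_norm (μ := μ) hp).const_mul
    ((2 : ℝ) ^ p)).integrableOn)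
    (Measurable.aestronglyMeasurable (by fun_prop)) ?_
  filter_upwards [ae_restrict_mem hX] with y hy
  have hy1 : 1 ≤ ‖y‖ := hy
  have hy0 : 0 < ‖y‖ := by linarith
  rw [Real.norm_of_nonneg (by positivity)]
  have h : (2 * ‖y‖) ^ (-p) ≤ (1 + ‖y‖) ^ (-p) :=
    Real.rpow_le_rpow_of_nonpos (by positivity) (by linarith) (by linarith)
  rw [Real.mul_rpow two_pos.le hy0.le] at h
  calc ‖y‖ ^ (-p) = 2 ^ p * (2 ^ (-p) * ‖y‖ ^ (-p)) := by
        rw [← mul_assoc, ← Real.rpow_add two_pos]; simp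
    _ ≤ _ := by gcongr

theorem exists_integral_radial_error_le {E : Type*} [NormedAddCommGroup E] [NormedSpace ℝ E]
    [FiniteDimensional ℝ E] [MeasurableSpace E] [BorelSpace E] (μ : Measure E)
    [μ.IsAddHaarMeasure] {V : ℝ → ℝ} (hpos : ∀ t, 0 < V t) (hanti : Antitone V) {α : ℝ}
    (hα : 0 < α)
    (hrv : ∀ x > (0 : ℝ), Tendsto (fun t => V (t * x) / V t) atTop (𝓝 (x ^ (-α))))
    {M : ℝ} (hM : 0 ≤ M) {ε : ℝ} (hε : 0 < ε) :
    ∃ η > (0 : ℝ), ∃ T₀ > (0 : ℝ), ∀ T ≥ T₀,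
      IntegrableOn (fun y : E => ‖y‖ ^ (-(Module.finrank ℝ E : ℝ)) *
        (η * (V (T * ‖y‖) / V T) + M * |V (T * ‖y‖) / V T - ‖y‖ ^ (-α)|)) {y | 1 ≤ ‖y‖} μ ∧
      ∫ y in {y : E | 1 ≤ ‖y‖}, ‖y‖ ^ (-(Module.finrank ℝ E : ℝ)) *
        (η * (V (T * ‖y‖) / V T) + M * |V (T * ‖y‖) / V T - ‖y‖ ^ (-α)|) ∂μ ≤ ε := by
  obtain ⟨β, hβ, K, hK, T₁, hT₁, hpot⟩ := exists_potter_bound hpos hanti hα hrv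
  set D : ℝ := (Module.finrank ℝ E : ℝ) with hD
  have hX : MeasurableSet {y : E | 1 ≤ ‖y‖} := measurableSet_le measurable_const measurable_norm
  have hVm : Measurable V := hanti.measurable
  have hintβ := integrableOn_norm_rpow_neg (E := E) μ (p := D + β) (by linarith)
  have hintα := integrableOn_norm_rpow_neg (E := E) μ (p := D + α) (by linarith)
  set J := ∫ y in {y : E | 1 ≤ ‖y‖}, K * ‖y‖ ^ (-(D + β)) ∂μ with hJ
  have hJ0 : 0 ≤ J := integral_nonneg fun y => by positivity
  have hsplit : ∀ y : E, 1 ≤ ‖y‖ → ∀ γ : ℝ, ‖y‖ ^ (-D) * ‖y‖ ^ (-γ) = ‖y‖ ^ (-(D + γ)) := by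
    intro y hy γ
    rw [← Real.rpow_add (by linarith)]
    congr 1; ring
  have hρ0 : ∀ T r, 0 ≤ V (T * r) / V T := fun T r => (div_pos (hpos _) (hpos _)).le
  have hbound : ∀ T ≥ T₁, ∀ y : E, 1 ≤ ‖y‖ →
      ‖y‖ ^ (-D) * (V (T * ‖y‖) / V T) ≤ K * ‖y‖ ^ (-(D + β)) := by
    intro T hT y hy
    rw [← hsplit y hy β]
    calc ‖y‖ ^ (-D) * (V (T * ‖y‖) / V T) ≤ ‖y‖ ^ (-D) * (K * ‖y‖ ^ (-β)) := by
          gcongr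
          exact hpot T hT _ hy
      _ = _ := by ring
  have hint1 : ∀ T ≥ T₁, IntegrableOn (fun y : E => ‖y‖ ^ (-D) * (V (T * ‖y‖) / V T))
      {y | 1 ≤ ‖y‖} μ := by
    intro T hT
    refine Integrable.mono' (hintβ.const_mul K)
      (Measurable.aestronglyMeasurable (by fun_prop)) ?_
    filter_upwards [ae_restrict_mem hX] with y hy
    rw [Real.norm_of_nonneg (mul_nonneg (by positivity) (hρ0 _ _))]
    exact hbound T hT y hy
  have hbound2 : ∀ T ≥ T₁, ∀ y : E, 1 ≤ ‖y‖ →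
      ‖‖y‖ ^ (-D) * |V (T * ‖y‖) / V T - ‖y‖ ^ (-α)|‖ ≤
        K * ‖y‖ ^ (-(D + β)) + ‖y‖ ^ (-(D + α)) := by
    intro T hT y hy
    rw [Real.norm_of_nonneg (by positivity), ← hsplit y hy α]
    have h1 := hbound T hT y hy
    have h2 : |V (T * ‖y‖) / V T - ‖y‖ ^ (-α)| ≤ V (T * ‖y‖) / V T + ‖y‖ ^ (-α) := by
      refine (abs_sub _ _).trans ?_
      rw [abs_of_nonneg (hρ0 _ _), abs_of_nonneg (by positivity)]
    calc _ ≤ ‖y‖ ^ (-D) * (V (T * ‖y‖) / V T + ‖y‖ ^ (-α)) := by gcongr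
      _ ≤ _ := by rw [mul_add]; linarith
  have hint2 : ∀ T ≥ T₁, IntegrableOn
      (fun y : E => ‖y‖ ^ (-D) * |V (T * ‖y‖) / V T - ‖y‖ ^ (-α)|) {y | 1 ≤ ‖y‖} μ := by
    intro T hT
    refine Integrable.mono' ((hintβ.const_mul K).add hintα)
      (Measurable.aestronglyMeasurable (by fun_prop)) ?_
    filter_upwards [ae_restrict_mem hX] with y hy
    exact hbound2 T hT y hy
  have hlim : Tendsto (fun T => ∫ y in {y : E | 1 ≤ ‖y‖},
      ‖y‖ ^ (-D) * |V (T * ‖y‖) / V T - ‖y‖ ^ (-α)| ∂μ) atTop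
      (𝓝 (∫ y in {y : E | 1 ≤ ‖y‖}, (0 : ℝ) ∂μ)) := by
    refine tendsto_integral_filter_of_dominated_convergence
      (fun y : E => K * ‖y‖ ^ (-(D + β)) + ‖y‖ ^ (-(D + α))) ?_ ?_
      ((hintβ.const_mul K).add hintα) ?_
    · exact Eventually.of_forall fun T => Measurable.aestronglyMeasurable (by fun_prop)
    · filter_upwards [eventually_ge_atTop T₁] with T hT
      filter_upwards [ae_restrict_mem hX] with y hy
      exact hbound2 T hT y hy
    · filter_upwards [ae_restrict_mem hX] with y hy
      have hy0 : 0 < ‖y‖ := lt_of_lt_of_le one_pos hy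
      have h := (((hrv ‖y‖ hy0).sub_const (‖y‖ ^ (-α))).abs).const_mul (‖y‖ ^ (-D))
      simpa using h
  rw [integral_zero] at hlim
  have hδ : 0 < ε / (2 * (M + 1)) := by positivity
  obtain ⟨T₂, hT₂⟩ := eventually_atTop.1 (hlim.eventually (gt_mem_nhds hδ))
  refine ⟨ε / (2 * (J + 1)), by positivity, max T₁ T₂, lt_max_of_lt_left hT₁, fun T hT => ?_⟩
  have hTT₁ : T ≥ T₁ := (le_max_left _ _).trans hT
  have hTT₂ : T ≥ T₂ := (le_max_right _ _).trans hT
  have hfun : (fun y : E => ‖y‖ ^ (-D) *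
        (ε / (2 * (J + 1)) * (V (T * ‖y‖) / V T) + M * |V (T * ‖y‖) / V T - ‖y‖ ^ (-α)|)) =
      fun y => ε / (2 * (J + 1)) * (‖y‖ ^ (-D) * (V (T * ‖y‖) / V T)) +
        M * (‖y‖ ^ (-D) * |V (T * ‖y‖) / V T - ‖y‖ ^ (-α)|) := by
    funext y; ring
  have hi1 := (hint1 T hTT₁).const_mul (ε / (2 * (J + 1)))
  have hi2 := (hint2 T hTT₁).const_mul M
  rw [hfun]
  refine ⟨hi1.add hi2, ?_⟩
  rw [integral_add hi1 hi2, integral_const_mul, integral_const_mul]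
  have h1 : ∫ y in {y : E | 1 ≤ ‖y‖}, ‖y‖ ^ (-D) * (V (T * ‖y‖) / V T) ∂μ ≤ J :=
    setIntegral_mono_on (hint1 T hTT₁) (hintβ.const_mul K) hX fun y hy => hbound T hTT₁ y hy
  have h2 := (hT₂ T hTT₂).le
  have e1 : ε / (2 * (J + 1)) * J ≤ ε / 2 := by
    rw [div_mul_eq_mul_div, div_le_div_iff₀ (by positivity) two_pos]; nlinarith
  have e2 : M * (ε / (2 * (M + 1))) ≤ ε / 2 := by
    rw [mul_div_assoc', div_le_div_iff₀ (by positivity) two_pos]; nlinarith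
  calc _ ≤ ε / (2 * (J + 1)) * J + M * (ε / (2 * (M + 1))) := by gcongr
    _ ≤ ε := by linarith

open Set Metric in
theorem exists_abs_setIntegral_cone_le {E : Type*} [NormedAddCommGroup E] [NormedSpace ℝ E]
    [FiniteDimensional ℝ E] [MeasurableSpace E] [BorelSpace E] (μ : Measure E)
    [μ.IsAddHaarMeasure] (m : ℕ) (hm0 : m ≠ 0) (hm : Module.finrank ℝ E = m + 1) :
    ∃ K : ℝ, 0 ≤ K ∧ ∀ C : Set E, MeasurableSet C → μH[(m : ℝ)] C ≠ ⊤ →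
      ∀ φ : ℝ → ℝ, Measurable φ → IntegrableOn (fun y : E => φ ‖y‖) {y | 1 ≤ ‖y‖} μ →
      ∀ h : E → ℝ, (∀ y, 1 ≤ ‖y‖ → |h y| ≤ φ ‖y‖) →
      |∫ y in {y : E | 1 ≤ ‖y‖ ∧ ‖y‖⁻¹ • y ∈ C}, h y ∂μ| ≤
        K * (μH[(m : ℝ)] C).toReal * ∫ y in {y : E | 1 ≤ ‖y‖}, φ ‖y‖ ∂μ := by
  have hnt : Nontrivial E := Module.nontrivial_of_finrank_pos (R := ℝ) (by omega)
  obtain ⟨K, hK, hKC⟩ := toSphere_le_hausdorffMeasure μ m hm0 hm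
  have hS0 : μ.toSphere univ ≠ 0 := 
    Measure.measure_univ_ne_zero.2 (Measure.toSphere_ne_zero μ)
  have hSt : μ.toSphere univ ≠ ⊤ := measure_ne_top _ _
  refine ⟨((μ.toSphere univ)⁻¹ * K).toReal, ENNReal.toReal_nonneg, ?_⟩
  intro C hC hCt φ hφ hint h hh
  have hX : MeasurableSet {y : E | 1 ≤ ‖y‖} := measurableSet_le measurable_const measurable_norm
  have hN : Measurable fun y : E => ‖y‖⁻¹ • y := by fun_prop
  have hNC : MeasurableSet {y : E | ‖y‖⁻¹ • y ∈ C} := hN hC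
  let ψ : ℝ → ENNReal := (Ici 1).indicator fun r => ENNReal.ofReal (φ r)
  have hψ : Measurable ψ := hφ.ennreal_ofReal.indicator measurableSet_Ici
  have hψind : (fun y : E => ψ ‖y‖) =
      {y : E | 1 ≤ ‖y‖}.indicator fun y => ENNReal.ofReal (φ ‖y‖) := by
    funext y
    simp [ψ, indicator]
  have hpol := toSphere_univ_mul_lintegral_cone_norm μ C hC ψ hψ
  have hI : ∫⁻ y, ψ ‖y‖ ∂μ = ENNReal.ofReal (∫ y in {y : E | 1 ≤ ‖y‖}, φ ‖y‖ ∂μ) := by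
    rw [hψind, lintegral_indicator hX, ofReal_integral_eq_lintegral_ofReal hint]
    filter_upwards [ae_restrict_mem hX] with y hy
    exact (abs_nonneg _).trans (hh y hy)
  have hI0 : 0 ≤ ∫ y in {y : E | 1 ≤ ‖y‖}, φ ‖y‖ ∂μ :=
    setIntegral_nonneg hX fun y hy => (abs_nonneg _).trans (hh y hy)
  have hle : ∫⁻ y in {y : E | ‖y‖⁻¹ • y ∈ C}, ψ ‖y‖ ∂μ ≤
      ((μ.toSphere univ)⁻¹ * K) * μH[(m : ℝ)] C *
        ENNReal.ofReal (∫ y in {y : E | 1 ≤ ‖y‖}, φ ‖y‖ ∂μ) := by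
    have : ∫⁻ y in {y : E | ‖y‖⁻¹ • y ∈ C}, ψ ‖y‖ ∂μ =
        (μ.toSphere univ)⁻¹ * (μ.toSphere ((↑) ⁻¹' C) * ∫⁻ y, ψ ‖y‖ ∂μ) := by
      rw [← hpol, ← mul_assoc, ENNReal.inv_mul_cancel hS0 hSt, one_mul]
    rw [this, hI, mul_assoc, mul_assoc, ← mul_assoc K]
    gcongr
    exact hKC C hC
  have habs : |∫ y in {y : E | 1 ≤ ‖y‖ ∧ ‖y‖⁻¹ • y ∈ C}, h y ∂μ| ≤
      (∫⁻ y in {y : E | ‖y‖⁻¹ • y ∈ C}, ψ ‖y‖ ∂μ).toReal := by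
    refine (norm_integral_le_lintegral_norm h).trans (ENNReal.toReal_mono ?_ ?_)
    · exact ne_top_of_le_ne_top (ENNReal.mul_ne_top (ENNReal.mul_ne_top
        (ENNReal.mul_ne_top (ENNReal.inv_ne_top.2 hS0) hK) hCt) ENNReal.ofReal_ne_top) hle
    · rw [hψind, setLIntegral_indicator hX]
      refine setLIntegral_mono (hφ.comp measurable_norm).ennreal_ofReal fun y hy => ?_
      exact ENNReal.ofReal_le_ofReal (hh y hy.1)
  refine habs.trans ?_
  have := ENNReal.toReal_mono (ENNReal.mul_ne_top (ENNReal.mul_ne_top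
        (ENNReal.mul_ne_top (ENNReal.inv_ne_top.2 hS0) hK) hCt) ENNReal.ofReal_ne_top) hle
  rwa [ENNReal.toReal_mul, ENNReal.toReal_mul, ENNReal.toReal_ofReal hI0] at this

open scoped Pointwise in
theorem exists_abs_tail_cone_sub_le {E : Type*} [NormedAddCommGroup E] [NormedSpace ℝ E]
    [FiniteDimensional ℝ E] [MeasurableSpace E] [BorelSpace E] (μ : Measure E)
    [μ.IsAddHaarMeasure] (m : ℕ) (hm0 : m ≠ 0) (hm : Module.finrank ℝ E = m + 1)
    {f : E → ℝ} (hf_cont : Continuous f) (hf_int : Integrable f μ)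
    {V : ℝ → ℝ} (hpos : ∀ t, 0 < V t) (hanti : Antitone V) {α : ℝ} (hα : 0 < α)
    (hrv : ∀ x > (0 : ℝ), Tendsto (fun t => V (t * x) / V t) atTop (𝓝 (x ^ (-α))))
    {q : E → ℝ} (hq_nonneg : ∀ z, z ≠ 0 → 0 ≤ q z)
    (hq_lim : ∀ z, z ≠ 0 → Tendsto
      (fun t : ℝ => f (t • z) / (t ^ (-(Module.finrank ℝ E : ℝ)) * V t)) atTop (𝓝 (q z)))
    (hq_unif : ∀ δ > (0 : ℝ), ∃ t₀ > (0 : ℝ), ∀ t ≥ t₀, ∀ z : E, ‖z‖ = 1 →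
      |f (t • z) / (t ^ (-(Module.finrank ℝ E : ℝ)) * V t) - q z| ≤ δ)
    (hq_int : IntegrableOn q {z | 1 ≤ ‖z‖} μ) {ε : ℝ} (hε : 0 < ε) :
    ∃ T₀ > (0 : ℝ), ∀ T ≥ T₀, ∀ C : Set E, MeasurableSet C → μH[(m : ℝ)] C ≠ ⊤ →
      |(∫ z in {z : E | T ≤ ‖z‖ ∧ ‖z‖⁻¹ • z ∈ C}, f z ∂μ) / V T -
          ∫ z in {z : E | 1 ≤ ‖z‖ ∧ ‖z‖⁻¹ • z ∈ C}, q z ∂μ| ≤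
        ε * (μH[(m : ℝ)] C).toReal := by
  have hnt : Nontrivial E := Module.nontrivial_of_finrank_pos (R := ℝ) (by omega)
  obtain ⟨K, hK0, hK⟩ := exists_abs_setIntegral_cone_le μ m hm0 hm
  set D : ℝ := (Module.finrank ℝ E : ℝ) with hD
  let G : ℝ → E → ℝ := fun t z => f (t • z) / (t ^ (-D) * V t)
  have hG : ∀ T > 0, ∀ r > 0, ∀ θ : E,
      G T (r • θ) = G (T * r) θ * (r ^ (-D) * (V (T * r) / V T)) := by
    intro T hT r hr θ
    simp only [G]
    rw [smul_smul, Real.mul_rpow hT.le hr.le]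
    have h1 := (hpos T).ne'
    have h2 := (hpos (T * r)).ne'
    have h3 := (Real.rpow_pos_of_pos hT (-D)).ne'
    have h4 := (Real.rpow_pos_of_pos hr (-D)).ne'
    field_simp
  have hhom : ∀ r > 0, ∀ θ : E, θ ≠ 0 → q (r • θ) = q θ * (r ^ (-D) * r ^ (-α)) := by
    intro r hr θ hθ
    have h1 : Tendsto (fun T => G T (r • θ)) atTop (𝓝 (q (r • θ))) :=
      hq_lim _ (smul_ne_zero hr.ne' hθ)
    have h2 : Tendsto (fun T => G (T * r) θ * (r ^ (-D) * (V (T * r) / V T))) atTop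
        (𝓝 (q θ * (r ^ (-D) * r ^ (-α)))) :=
      ((hq_lim θ hθ).comp (tendsto_id.atTop_mul_const hr)).mul ((hrv r hr).const_mul _)
    refine tendsto_nhds_unique (h1.congr' ?_) h2
    filter_upwards [eventually_gt_atTop 0] with T hT
    exact hG T hT r hr θ
  obtain ⟨M, hM0, hM⟩ : ∃ M : ℝ, 0 ≤ M ∧ ∀ θ : E, ‖θ‖ = 1 → q θ ≤ M := by
    obtain ⟨t₀, -, ht⟩ := hq_unif 1 one_pos
    have hcont : Continuous fun θ : E => f (t₀ • θ) / (t₀ ^ (-D) * V t₀) := by fun_prop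
    obtain ⟨B, hB⟩ := (isCompact_sphere (0 : E) 1).exists_bound_of_continuousOn hcont.continuousOn
    refine ⟨max (B + 1) 0, le_max_right _ _, fun θ hθ => le_max_of_le_left ?_⟩
    have h1 := (abs_le.1 (ht t₀ le_rfl θ hθ)).1
    have h2 := hB θ (by simpa using hθ)
    rw [Real.norm_eq_abs] at h2
    linarith [(abs_le.1 h2).2]
  have hε' : 0 < ε / (K + 1) := by positivity
  obtain ⟨η, hη, T₁, hT₁, hrad⟩ :=
    exists_integral_radial_error_le μ hpos hanti hα hrv hM0 hε'
  obtain ⟨T₂, hT₂, hunif⟩ := hq_unif η hη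
  refine ⟨max T₁ T₂, lt_max_of_lt_left hT₁, fun T hT C hC hCt => ?_⟩
  have hTT₁ : T ≥ T₁ := (le_max_left _ _).trans hT
  have hTT₂ : T ≥ T₂ := (le_max_right _ _).trans hT
  have hT0 : 0 < T := hT₁.trans_le hTT₁
  obtain ⟨hφint, hφle⟩ := hrad T hTT₁
  let φ : ℝ → ℝ := fun r => r ^ (-D) *
    (η * (V (T * r) / V T) + M * |V (T * r) / V T - r ^ (-α)|)
  have hVm : Measurable V := hanti.measurable
  have hφm : Measurable φ := by fun_prop
  have hpt : ∀ y : E, 1 ≤ ‖y‖ → |G T y - q y| ≤ φ ‖y‖ := by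
    intro y hy
    have hr : 0 < ‖y‖ := by linarith
    obtain ⟨θ, hθ, hyθ⟩ : ∃ θ : E, ‖θ‖ = 1 ∧ y = ‖y‖ • θ := by
      refine ⟨‖y‖⁻¹ • y, ?_, ?_⟩
      · rw [norm_smul, norm_inv, norm_norm, inv_mul_cancel₀ hr.ne']
      · rw [smul_inv_smul₀ hr.ne']
    have hθ0 : θ ≠ 0 := by rintro rfl; simp at hθ
    set r := ‖y‖ with hrdef
    have hρ : 0 < V (T * r) / V T := div_pos (hpos _) (hpos _)
    rw [hyθ, hG T hT0 r hr, hhom r hr θ hθ0]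
    have h1 : |G (T * r) θ - q θ| ≤ η :=
      hunif (T * r) (hTT₂.le.trans (le_mul_of_one_le_right hT0.le hy)) θ hθ
    have h2 := hM θ hθ
    have h3 := hq_nonneg θ hθ0
    have hrw : G (T * r) θ * (r ^ (-D) * (V (T * r) / V T)) - q θ * (r ^ (-D) * r ^ (-α)) =
        r ^ (-D) * ((G (T * r) θ - q θ) * (V (T * r) / V T) +
          q θ * (V (T * r) / V T - r ^ (-α))) := by ring
    rw [hrw, abs_mul, abs_of_pos (Real.rpow_pos_of_pos hr (-D))]
    refine mul_le_mul_of_nonneg_left ?_ (by positivity)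
    refine (abs_add_le _ _).trans ?_
    rw [abs_mul, abs_mul, abs_of_pos hρ, abs_of_nonneg h3]
    gcongr
  have hNm : Measurable fun y : E => ‖y‖⁻¹ • y := by fun_prop
  have hset : T • {z : E | 1 ≤ ‖z‖ ∧ ‖z‖⁻¹ • z ∈ C} = {z : E | T ≤ ‖z‖ ∧ ‖z‖⁻¹ • z ∈ C} := by
    ext z
    rw [Set.mem_smul_set_iff_inv_smul_mem₀ hT0.ne']
    simp only [Set.mem_ofPred_eq, norm_smul, norm_inv, Real.norm_eq_abs, abs_of_pos hT0]
    have e1 : (1 ≤ T⁻¹ * ‖z‖) ↔ T ≤ ‖z‖ := by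
      rw [le_inv_mul_iff₀ hT0, mul_one]
    have e2 : (T⁻¹ * ‖z‖)⁻¹ • T⁻¹ • z = ‖z‖⁻¹ • z := by
      rw [smul_smul]; congr 1
      rw [mul_inv, inv_inv, mul_right_comm, mul_inv_cancel₀ hT0.ne', one_mul]
    rw [e1, e2]
  have hsub : (∫ z in {z : E | T ≤ ‖z‖ ∧ ‖z‖⁻¹ • z ∈ C}, f z ∂μ) / V T =
      ∫ y in {y : E | 1 ≤ ‖y‖ ∧ ‖y‖⁻¹ • y ∈ C}, G T y ∂μ := by
    have h := Measure.setIntegral_comp_smul_of_pos μ f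
      {z : E | 1 ≤ ‖z‖ ∧ ‖z‖⁻¹ • z ∈ C} hT0
    rw [hset, smul_eq_mul] at h
    simp only [G]
    rw [integral_div, h, hD, Real.rpow_neg hT0.le, Real.rpow_natCast]
    have h1 := (hpos T).ne'
    have h2 : T ^ Module.finrank ℝ E ≠ 0 := by positivity
    field_simp
  have hGint : Integrable (G T) μ := (hf_int.comp_smul hT0.ne').div_const _
  rw [hsub, ← integral_sub hGint.integrableOn (hq_int.mono_set fun y hy => hy.1)]
  refine (hK C hC hCt φ hφm hφint _ hpt).trans ?_
  calc K * (μH[(m : ℝ)] C).toReal * ∫ y in {y : E | 1 ≤ ‖y‖}, φ ‖y‖ ∂μ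
      ≤ K * (μH[(m : ℝ)] C).toReal * (ε / (K + 1)) := by
        gcongr
    _ = (K * (ε / (K + 1))) * (μH[(m : ℝ)] C).toReal := by ring
    _ ≤ ε * (μH[(m : ℝ)] C).toReal := by
        gcongr
        rw [mul_div_assoc', div_le_iff₀ (by positivity)]
        linarith

theorem norm_tail_pos_antitone_continuous {E : Type*} [NormedAddCommGroup E] [NormedSpace ℝ E]
    [FiniteDimensional ℝ E] [Nontrivial E] [MeasurableSpace E] [BorelSpace E] (μ : Measure E)
    [μ.IsAddHaarMeasure] (P : Measure E) [IsProbabilityMeasure P] (hPμ : P ≪ μ) (hμP : μ ≪ P)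
    {V : ℝ → ℝ} (hV : ∀ t : ℝ, V t = (P {z | t < ‖z‖}).toReal) :
    (∀ t, 0 < V t) ∧ Antitone V ∧ StrictAntiOn V (Set.Ici 0) ∧ Continuous V := by
  have hmeas : ∀ t : ℝ, MeasurableSet {z : E | t < ‖z‖} := fun t =>
    measurableSet_lt measurable_const measurable_norm
  have hopen : ∀ U : Set E, IsOpen U → U.Nonempty → 0 < P U := fun U hU hne =>
    pos_iff_ne_zero.2 fun h => (hU.measure_pos μ hne).ne' (hμP h)
  obtain ⟨v, hv⟩ := exists_norm_eq E (zero_le_one' ℝ)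
  have hnorm : ∀ t : ℝ, 0 ≤ t → ‖t • v‖ = t := fun t ht => by
    rw [norm_smul, hv, mul_one, Real.norm_of_nonneg ht]
  have hanti : Antitone V := fun s t hst => by
    rw [hV, hV]
    exact ENNReal.toReal_mono (measure_ne_top _ _)
      (measure_mono fun z (hz : t < ‖z‖) => hst.trans_lt hz)
  refine ⟨fun t => ?_, hanti, fun s hs t ht hst => ?_, ?_⟩
  · rw [hV]
    refine ENNReal.toReal_pos (hopen _ (isOpen_lt continuous_const continuous_norm) ?_).ne'
      (measure_ne_top _ _)
    refine ⟨(|t| + 1) • v, ?_⟩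
    rw [Set.mem_ofPred_eq, hnorm _ (by positivity)]
    linarith [le_abs_self t]
  · have hs0 : 0 ≤ s := hs
    rw [hV, hV]
    have hU : 0 < P {z : E | s < ‖z‖ ∧ ‖z‖ < t} := by
      refine hopen _ ((isOpen_lt continuous_const continuous_norm).inter
        (isOpen_lt continuous_norm continuous_const)) ⟨((s + t) / 2) • v, ?_⟩
      rw [Set.mem_ofPred_eq, hnorm _ (by linarith)]
      constructor <;> linarith
    refine ENNReal.toReal_strict_mono (measure_ne_top _ _) ?_
    calc P {z : E | t < ‖z‖}
        < P {z : E | s < ‖z‖ ∧ ‖z‖ < t} + P {z : E | t < ‖z‖} :=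
          by rw [add_comm]; exact ENNReal.lt_add_right (measure_ne_top _ _) hU.ne'
      _ = P ({z : E | s < ‖z‖ ∧ ‖z‖ < t} ∪ {z : E | t < ‖z‖}) := by
          refine (measure_union ?_ (hmeas t)).symm
          rw [Set.disjoint_left]
          exact fun z h1 h2 => lt_asymm h1.2 h2
      _ ≤ P {z : E | s < ‖z‖} := by
          refine measure_mono ?_
          rintro z (h | h)
          · exact h.1
          · exact hst.trans h
  · have hVint : V = fun t => ∫ z, {z : E | t < ‖z‖}.indicator (fun _ => (1 : ℝ)) z ∂P := by
      funext t
      rw [hV, integral_indicator_const _ (hmeas t), smul_eq_mul, mul_one]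
      rfl
    rw [hVint, continuous_iff_continuousAt]
    intro t
    refine continuousAt_of_dominated (bound := fun _ => 1) ?_ ?_ (integrable_const _) ?_
    · exact Eventually.of_forall fun s =>
        (measurable_const.indicator (hmeas s)).aestronglyMeasurable
    · refine Eventually.of_forall fun s => Eventually.of_forall fun z => ?_
      by_cases h : s < ‖z‖ <;> simp [Set.indicator, h]
    · have hnull : P {z : E | ¬ ‖z‖ ≠ t} = 0 := by
        refine hPμ ?_
        convert Measure.addHaar_sphere μ (0 : E) t using 2
        ext z; simp
      filter_upwards [measure_eq_zero_iff_ae_notMem.1 hnull] with z hz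
      have hz' : ‖z‖ ≠ t := fun h => hz (by simpa using h)
      rcases lt_or_gt_of_ne hz' with h | h
      · refine (continuousAt_const (y := (0 : ℝ))).congr ?_
        filter_upwards [lt_mem_nhds h] with s hs
        simp [Set.indicator, hs.le]
      · refine (continuousAt_const (y := (1 : ℝ))).congr ?_
        filter_upwards [gt_mem_nhds h] with s hs
        simp [Set.indicator, hs]

/-- relation (p2.4): With `P̃` the law of `(W, 1 − H(R))` and
`Ψ(C) = ν({z : ‖z‖ ≥ 1, z/‖z‖ ∈ C})`, uniformly over all spherical caps
`C = C_w(a)`, `0 < a ≤ 1`, and all `0 < s ≤ 2`,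
`(1/λ(C)) |(n/k) P̃(C × (0, sk/n]) − s Ψ(C)| → 0` as `n → ∞`. -/
theorem empirical_cap_measure_uniform_convergence
    (d : ℕ) (hd : 2 ≤ d)
    (P : Measure (EuclideanSpace ℝ (Fin d))) [IsProbabilityMeasure P]
    (f : EuclideanSpace ℝ (Fin d) → ℝ)
    (hf_cont : Continuous f) (hf_pos : ∀ z, 0 < f z)
    (hP : P = volume.withDensity (fun z => ENNReal.ofReal (f z)))
    (α : ℝ) (hα : 0 < α)
    -- V = 1 − H, regularly varying with index −α
    (V : ℝ → ℝ)
    (hV_def : ∀ t : ℝ, V t = (P {z | t < ‖z‖}).toReal)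
    (hV_rv : ∀ x > (0 : ℝ),
      Tendsto (fun t => V (t * x) / V t) atTop (𝓝 (x ^ (-α))))
    (q : EuclideanSpace ℝ (Fin d) → ℝ)
    (hq_nonneg : ∀ z : EuclideanSpace ℝ (Fin d), z ≠ 0 → 0 ≤ q z)
    (hq_lim : ∀ z : EuclideanSpace ℝ (Fin d), z ≠ 0 →
      Tendsto (fun t : ℝ => f (t • z) / (t ^ (-(d : ℝ)) * V t)) atTop (𝓝 (q z)))
    (hq_unif : ∀ δ > (0 : ℝ), ∃ t₀ > (0 : ℝ), ∀ t ≥ t₀,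
      ∀ z : EuclideanSpace ℝ (Fin d), ‖z‖ = 1 →
        |f (t • z) / (t ^ (-(d : ℝ)) * V t) - q z| ≤ δ)
    (hq_int : IntegrableOn q {z : EuclideanSpace ℝ (Fin d) | 1 ≤ ‖z‖} volume)
    -- condition (b)
    (k : ℕ → ℕ) (hk_pos : ∀ n, 0 < k n)
    (hk_top : Tendsto (fun n => (k n : ℝ)) atTop atTop)
    (hkn : Tendsto (fun n => (k n : ℝ) / n) atTop (𝓝 0)) :
    ∀ δ > (0 : ℝ), ∃ n₀ : ℕ, ∀ n ≥ n₀,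
      ∀ w : EuclideanSpace ℝ (Fin d), ‖w‖ = 1 →
      ∀ a ∈ Set.Ioc (0 : ℝ) 1, ∀ s ∈ Set.Ioc (0 : ℝ) 2,
        |((n : ℝ) / k n) *
            (P {z : EuclideanSpace ℝ (Fin d) |
                ‖z‖⁻¹ • z ∈ {v : EuclideanSpace ℝ (Fin d) | ‖v‖ = 1 ∧ 1 - a ≤ ⟪w, v⟫} ∧
                1 - (P {z' : EuclideanSpace ℝ (Fin d) | ‖z'‖ ≤ ‖z‖}).toReal ∈
                  Set.Ioc (0 : ℝ) (s * k n / n)}).toReal -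
          s * ∫ z in {z : EuclideanSpace ℝ (Fin d) |
                1 ≤ ‖z‖ ∧ ‖z‖⁻¹ • z ∈
                  {v : EuclideanSpace ℝ (Fin d) | ‖v‖ = 1 ∧ 1 - a ≤ ⟪w, v⟫}}, q z| ≤
        δ * (μH[(d : ℝ) - 1]
            {v : EuclideanSpace ℝ (Fin d) | ‖v‖ = 1 ∧ 1 - a ≤ ⟪w, v⟫}).toReal := by
  obtain ⟨m, rfl⟩ : ∃ m, d = m + 1 := ⟨d - 1, by omega⟩
  have hm0 : m ≠ 0 := by omega
  have hcast : ((m + 1 : ℕ) : ℝ) - 1 = m := by push_cast; ring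
  have hfin : Module.finrank ℝ (EuclideanSpace ℝ (Fin (m + 1))) = m + 1 := by simp
  have hfm : Measurable fun z => ENNReal.ofReal (f z) := hf_cont.measurable.ennreal_ofReal
  have hPμ : P ≪ volume := hP ▸ withDensity_absolutelyContinuous _ _
  have hμP : volume ≪ P := hP ▸ withDensity_absolutelyContinuous' hfm.aemeasurable
    (Eventually.of_forall fun z => (ENNReal.ofReal_pos.2 (hf_pos z)).ne')
  have hnt : Nontrivial (EuclideanSpace ℝ (Fin (m + 1))) :=
    Module.nontrivial_of_finrank_pos (R := ℝ) (by omega)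
  obtain ⟨hVpos, hVanti, hVstrict, hVcont⟩ := norm_tail_pos_antitone_continuous volume P hPμ hμP hV_def
  have hPint : ∀ S, MeasurableSet S → (P S).toReal = ∫ z in S, f z := by
    intro S hS
    rw [hP, withDensity_apply _ hS, integral_eq_lintegral_of_nonneg_ae
      (Eventually.of_forall fun z => (hf_pos z).le) hf_cont.aestronglyMeasurable]
  have hf_int : Integrable f := by
    refine ⟨hf_cont.aestronglyMeasurable, ?_⟩
    rw [hasFiniteIntegral_iff_ofReal (Eventually.of_forall fun z => (hf_pos z).le),
      ← setLIntegral_univ, ← withDensity_apply _ MeasurableSet.univ, ← hP]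
    exact measure_lt_top _ _
  have hV0 : Tendsto V atTop (𝓝 0) := by
    obtain ⟨β, hβ, K, hK, T₁, hT₁, hpot⟩ := exists_potter_bound hVpos hVanti hα hV_rv
    have hlim : Tendsto (fun T => K * (T * T₁⁻¹) ^ (-β) * V T₁) atTop (𝓝 (K * 0 * V T₁)) :=
      (((tendsto_rpow_neg_atTop hβ).comp
        (tendsto_id.atTop_mul_const (inv_pos.2 hT₁))).const_mul K).mul_const _
    rw [mul_zero, zero_mul] at hlim
    refine squeeze_zero' (Eventually.of_forall fun t => (hVpos t).le) ?_ hlim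
    filter_upwards [eventually_ge_atTop T₁] with T hT
    have h := hpot T₁ le_rfl (T * T₁⁻¹) (by rwa [ge_iff_le, ← div_eq_mul_inv, one_le_div hT₁])
    rw [div_le_iff₀ (hVpos _)] at h
    rwa [mul_left_comm, mul_inv_cancel₀ hT₁.ne', mul_one] at h
  intro δ hδ
  obtain ⟨T₀, hT₀, hmain⟩ := exists_abs_tail_cone_sub_le volume m hm0 hfin hf_cont hf_int hVpos
    hVanti hα hV_rv hq_nonneg (by rw [hfin]; exact hq_lim) (by rw [hfin]; exact hq_unif) hq_int
    (half_pos hδ)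
  obtain ⟨n₀, hn₀⟩ := eventually_atTop.1
    ((hkn.eventually (gt_mem_nhds (half_pos (hVpos T₀)))).and (eventually_gt_atTop 0))
  refine ⟨n₀, fun n hn w hw a ha s hs => ?_⟩
  obtain ⟨hkn', hnpos⟩ := hn₀ n hn
  have hn0 : (0 : ℝ) < n := by exact_mod_cast hnpos
  have hk0 : (0 : ℝ) < k n := by exact_mod_cast hk_pos n
  rw [hcast]
  set C := {v : EuclideanSpace ℝ (Fin (m + 1)) | ‖v‖ = 1 ∧ 1 - a ≤ ⟪w, v⟫} with hCdef
  have hC : MeasurableSet C := by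
    have h1 : IsClosed {v : EuclideanSpace ℝ (Fin (m + 1)) | ‖v‖ = 1} :=
      isClosed_eq continuous_norm continuous_const
    have h2 : IsClosed {v : EuclideanSpace ℝ (Fin (m + 1)) | 1 - a ≤ ⟪w, v⟫} :=
      isClosed_le (by fun_prop) (by fun_prop)
    exact (h1.inter h2).measurableSet
  have hCt : μH[(m : ℝ)] C ≠ ⊤ := by
    refine ne_top_of_le_ne_top (hausdorffMeasure_unitSphere_lt_top m).ne (measure_mono ?_)
    intro v hv
    simpa using hv.1
  set u := s * k n / n with hu
  have hu0 : 0 < u := div_pos (mul_pos hs.1 hk0) hn0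
  have huT₀ : u < V T₀ := by
    have h1 : u ≤ 2 * (k n / n) := by
      rw [hu, mul_div_assoc]
      exact mul_le_mul_of_nonneg_right hs.2 (by positivity)
    linarith
  obtain ⟨T, hT, hVT⟩ : ∃ T, T₀ ≤ T ∧ V T = u := by
    obtain ⟨T₁, hT₁, hT₁'⟩ := ((hV0.eventually (gt_mem_nhds hu0)).and
      (eventually_ge_atTop T₀)).exists
    obtain ⟨T, hT, h⟩ := intermediate_value_Icc' hT₁' hVcont.continuousOn ⟨hT₁.le, huT₀.le⟩
    exact ⟨T, hT.1, h⟩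
  have hT0 : 0 < T := hT₀.trans_le hT
  have hcompl : ∀ r : ℝ,
      1 - (P {z' : EuclideanSpace ℝ (Fin (m + 1)) | ‖z'‖ ≤ r}).toReal = V r := by
    intro r
    have hms : MeasurableSet {z' : EuclideanSpace ℝ (Fin (m + 1)) | ‖z'‖ ≤ r} :=
      measurableSet_le measurable_norm measurable_const
    have hset : {z : EuclideanSpace ℝ (Fin (m + 1)) | r < ‖z‖} =
        {z' : EuclideanSpace ℝ (Fin (m + 1)) | ‖z'‖ ≤ r}ᶜ := by
      ext z; simp
    rw [hV_def, hset]
    exact (probReal_compl_eq_one_sub hms).symm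
  have hevent : {z : EuclideanSpace ℝ (Fin (m + 1)) | ‖z‖⁻¹ • z ∈ C ∧
      1 - (P {z' : EuclideanSpace ℝ (Fin (m + 1)) | ‖z'‖ ≤ ‖z‖}).toReal ∈ Set.Ioc (0 : ℝ) u} =
      {z | T ≤ ‖z‖ ∧ ‖z‖⁻¹ • z ∈ C} := by
    ext z
    have h : V ‖z‖ ≤ V T ↔ T ≤ ‖z‖ := hVstrict.le_iff_ge (norm_nonneg z) hT0.le
    simp only [Set.mem_ofPred_eq, hcompl, Set.mem_Ioc, ← hVT, h, hVpos, true_and]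
    exact and_comm
  have hms : MeasurableSet {z : EuclideanSpace ℝ (Fin (m + 1)) | T ≤ ‖z‖ ∧ ‖z‖⁻¹ • z ∈ C} :=
    (measurableSet_le measurable_const measurable_norm).inter
      ((show Measurable fun z : EuclideanSpace ℝ (Fin (m + 1)) => ‖z‖⁻¹ • z by fun_prop) hC)
  have hfinal := hmain T hT C hC hCt
  rw [hevent, hPint _ hms]
  have hrw : ∀ A B : ℝ, (n : ℝ) / k n * A - s * B = s * (A / V T - B) := by
    intro A B
    have hs0 := hs.1.ne'
    rw [hVT, hu]
    field_simp
  rw [hrw, abs_mul, abs_of_pos hs.1]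
  calc s * _ ≤ 2 * (δ / 2 * (μH[(m : ℝ)] C).toReal) :=
        mul_le_mul hs.2 hfinal (abs_nonneg _) two_pos.le
    _ = δ * (μH[(m : ℝ)] C).toReal := by ring
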